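/- For every δ > 0 there exists n₀ = n₀(δ) such that the following holds for all n ≥ n₀. Let G be an edge-coloured multigraph with |V(G)| = n and δ*_mon(G) ≥ δn. Then there exists a subgraph G* of G such that |V(G) \ V(G*)| < 2000·δ^(−4) and |φ(G) \ φ(G*)| < 2000·δ^(−4), and moreover: for every rainbow path P* in G* with |V(P*)| ≥ 3 and every vertex set S ⊆ V(G*) \ V(P*) with |V(P*) ∪ S| ≤ δn/4, the graph G \ S contains a rainbow cycle C* with φ(P*) ⊆ φ(C*) ⊆ φ(P*) ∪ (φ(G) \ φ(G*)). -/

import Mathlib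

/-- An edge-coloured multigraph on `Fin n` is modelled as a family `G : γ → SimpleGraph (Fin n)`
of colour classes: `G c` is the simple graph formed by the edges of colour `c` (parallel edges
get distinct colours).  `(s, cs)` is a rainbow cycle with vertex set `s` and colour set `cs`:
either a single edge (a degenerate cycle), or a cyclic sequence of at least two distinct
vertices in which consecutive vertices are joined by edges of pairwise distinct colours. -/
def IsRainbowCycle {n : ℕ} {γ : Type*} [DecidableEq γ] (G : γ → SimpleGraph (Fin n))
    (s : Finset (Fin n)) (cs : Finset γ) : Prop :=
  (∃ (u v : Fin n) (c : γ), (G c).Adj u v ∧ s = {u, v} ∧ cs = {c}) ∨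
  (∃ (m : ℕ) (f : ℕ → Fin n) (col : ℕ → γ),
    2 ≤ m ∧ m = s.card ∧
    (∀ i, f (i + m) = f i) ∧ Set.InjOn f (Set.Iio m) ∧ (Finset.range m).image f = s ∧
    (∀ i, col (i + m) = col i) ∧ Set.InjOn col (Set.Iio m) ∧
    (Finset.range m).image col = cs ∧
    ∀ i, (G (col i)).Adj (f i) (f (i + 1)))

/-- `(s, cs)` is a rainbow path with vertex set `s` and colour set `cs` in the edge-coloured
multigraph given by the family `G` of colour classes: a sequence of `m ≥ 2` distinct vertices
in which consecutive vertices are joined by edges of pairwise distinct colours. -/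
def IsRainbowPath {n : ℕ} {γ : Type*} [DecidableEq γ] (G : γ → SimpleGraph (Fin n))
    (s : Finset (Fin n)) (cs : Finset γ) : Prop :=
  ∃ (m : ℕ) (f : ℕ → Fin n) (col : ℕ → γ),
    2 ≤ m ∧ m = s.card ∧
    Set.InjOn f (Set.Iio m) ∧ (Finset.range m).image f = s ∧
    Set.InjOn col (Set.Iio (m - 1)) ∧ (Finset.range (m - 1)).image col = cs ∧
    ∀ i < m - 1, (G (col i)).Adj (f i) (f (i + 1))

/-- A multiset of demands can be covered greedily: there is a small set `R` such that every
element outside `R` meets at most `t` of the elements that meet `R` fewer than `K` times. -/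
lemma exists_greedy_cover {α β : Type*} [Fintype α] [Fintype β] [DecidableEq β]
    (r : α → β → Prop) [∀ a b, Decidable (r a b)] (K : ℕ) (t : ℝ) :
    ∃ R : Finset β, t * (R.card : ℝ) ≤ K * (Fintype.card α : ℝ) ∧
      ∀ b ∉ R, ((Finset.univ.filter fun a => r a b ∧ (R.filter (r a)).card < K).card : ℝ) ≤ t := by
  let Φ : Finset β → ℝ := fun R =>
    ((∑ a : α, (K - (R.filter (r a)).card) : ℕ) : ℝ) + t * (R.card : ℝ)
  obtain ⟨R, hR⟩ := Finite.exists_min Φ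
  refine ⟨R, ?_, fun b hb => ?_⟩
  · have h0 := hR ∅
    simp only [Φ, Finset.filter_empty, Finset.card_empty, Nat.sub_zero, Finset.sum_const,
      Finset.card_univ, smul_eq_mul, Nat.cast_zero, mul_zero, add_zero, Nat.cast_mul] at h0
    have : (0 : ℝ) ≤ ((∑ a : α, (K - (R.filter (r a)).card) : ℕ) : ℝ) := Nat.cast_nonneg _
    linarith
  · have h1 := hR (insert b R)
    simp only [Φ, Finset.card_insert_of_notMem hb] at h1
    have h2 : (∑ a : α, (K - ((insert b R).filter (r a)).card)) +
        (Finset.univ.filter fun a => r a b ∧ (R.filter (r a)).card < K).card ≤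
        ∑ a : α, (K - (R.filter (r a)).card) := by
      rw [Finset.card_filter, ← Finset.sum_add_distrib]
      refine Finset.sum_le_sum fun a _ => ?_
      have hb' : b ∉ R.filter (r a) := fun h => hb (Finset.mem_filter.1 h).1
      rw [Finset.filter_insert]
      split_ifs with h3 h4 h5
      · rw [Finset.card_insert_of_notMem hb']; omega
      · rw [Finset.card_insert_of_notMem hb']; omega
      · exact absurd h5.1 h3
      · omega
    have h3 : ((∑ a : α, (K - ((insert b R).filter (r a)).card) : ℕ) : ℝ) +
        ((Finset.univ.filter fun a => r a b ∧ (R.filter (r a)).card < K).card : ℝ) ≤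
        ((∑ a : α, (K - (R.filter (r a)).card) : ℕ) : ℝ) := by exact_mod_cast h2
    push_cast at h1 h3
    linarith

open Classical in
/-- If `u` sees at least `K` colours of `R`, each with degree at least `d`, then many vertices
are joined to `u` by at least `m` colours of `R`. -/
lemma mul_le_card_multiple_neighbours {V γ : Type*} [Fintype V] (G : γ → SimpleGraph V)
    (R : Finset γ) (u : V) (K m : ℕ) (d : ℝ)
    (hK : K ≤ (R.filter fun c => ∃ w, (G c).Adj u w).card)
    (hd : ∀ c ∈ R, (∃ w, (G c).Adj u w) → d ≤ ((Finset.univ.filter ((G c).Adj u)).card : ℝ)) :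
    K * d ≤ K * ((Finset.univ.filter fun y => m ≤ (R.filter fun c => (G c).Adj u y).card).card : ℝ)
      + m * (Fintype.card V : ℝ) := by
  obtain ⟨T, hT, hTK⟩ := Finset.exists_subset_card_eq hK
  have hTR : T ⊆ R := fun c hc => (Finset.mem_filter.1 (hT hc)).1
  have h1 : (K : ℝ) * d ≤ ∑ c ∈ T, ((Finset.univ.filter ((G c).Adj u)).card : ℝ) := by
    rw [← hTK, ← nsmul_eq_mul]
    exact Finset.card_nsmul_le_sum _ _ _ fun c hc =>
      hd c (hTR hc) (Finset.mem_filter.1 (hT hc)).2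
  have h2 : ∑ c ∈ T, (Finset.univ.filter ((G c).Adj u)).card =
      ∑ y : V, (T.filter fun c => (G c).Adj u y).card :=
    Finset.sum_card_bipartiteAbove_eq_sum_card_bipartiteBelow (fun c y => (G c).Adj u y)
  have h3 : ∑ y : V, (T.filter fun c => (G c).Adj u y).card ≤
      K * (Finset.univ.filter fun y => m ≤ (R.filter fun c => (G c).Adj u y).card).card
        + m * Fintype.card V := by
    have h4 : ∀ y : V, (T.filter fun c => (G c).Adj u y).card ≤
        K * (if m ≤ (R.filter fun c => (G c).Adj u y).card then 1 else 0) + m := by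
      intro y
      split_ifs with hy
      · have := Finset.card_filter_le T fun c => (G c).Adj u y
        omega
      · have := Finset.card_le_card
          (Finset.filter_subset_filter (fun c => (G c).Adj u y) hTR)
        omega
    refine (Finset.sum_le_sum fun y _ => h4 y).trans (le_of_eq ?_)
    rw [Finset.sum_add_distrib, ← Finset.mul_sum, Finset.card_filter]
    simp [mul_comm]
  calc (K : ℝ) * d ≤ ((∑ c ∈ T, (Finset.univ.filter ((G c).Adj u)).card : ℕ) : ℝ) := by
        push_cast; exact h1
    _ ≤ _ := by rw [h2]; exact_mod_cast h3

/-- `IsTrail G u v l` says that the list `l` of (colour, vertex) steps leads from `u` to `v`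
along edges of the colour classes `G`. -/
def IsTrail {V γ : Type*} (G : γ → SimpleGraph V) : V → V → List (γ × V) → Prop
  | u, v, [] => u = v
  | u, v, (c, w) :: l => (G c).Adj u w ∧ IsTrail G w v l

lemma IsTrail.append {V γ : Type*} {G : γ → SimpleGraph V} {u v w : V} {l l' : List (γ × V)}
    (h : IsTrail G u v l) (h' : IsTrail G v w l') : IsTrail G u w (l ++ l') := by
  induction l generalizing u with
  | nil => obtain rfl : u = v := h; exact h'
  | cons a l ih => exact ⟨h.1, ih h.2⟩

lemma IsTrail.adj_head {V γ : Type*} {G : γ → SimpleGraph V} {u v : V} {l : List (γ × V)}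
    (h : IsTrail G u v l) (h0 : 0 < l.length) : (G l[0].1).Adj u l[0].2 := by
  cases l with
  | nil => simp at h0
  | cons a l => exact h.1

lemma IsTrail.adj_getElem {V γ : Type*} {G : γ → SimpleGraph V} {u v : V} {l : List (γ × V)}
    (h : IsTrail G u v l) (j : ℕ) (hj : j + 1 < l.length) :
    (G l[j + 1].1).Adj l[j].2 l[j + 1].2 := by
  induction l generalizing u j with
  | nil => simp at hj
  | cons a l ih =>
    cases j with
    | zero => exact IsTrail.adj_head h.2 (by simpa using hj)
    | succ j => exact ih h.2 j (by simpa using hj)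

lemma IsTrail.getElem_last {V γ : Type*} {G : γ → SimpleGraph V} {u v : V} {l : List (γ × V)}
    (h : IsTrail G u v l) (h0 : 0 < l.length) : l[l.length - 1].2 = v := by
  induction l generalizing u with
  | nil => simp at h0
  | cons a l ih =>
    cases l with
    | nil => exact h.2
    | cons b l => simpa using ih h.2 (by simp)

lemma isTrail_map_range {V γ : Type*} {G : γ → SimpleGraph V} (f : ℕ → V) (col : ℕ → γ)
    (a t : ℕ) (h : ∀ i < t, (G (col (a + i))).Adj (f (a + i)) (f (a + i + 1))) :
    IsTrail G (f a) (f (a + t)) ((List.range t).map fun i => (col (a + i), f (a + i + 1))) := by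
  induction t with
  | zero => rfl
  | succ t ih =>
    rw [List.range_succ, List.map_append]
    exact (ih fun i hi => h i (by omega)).append ⟨h t (by omega), rfl⟩

lemma IsTrail.isRainbowCycle {n : ℕ} {γ : Type*} [DecidableEq γ] {G : γ → SimpleGraph (Fin n)}
    {u : Fin n} {l : List (γ × Fin n)} (h : IsTrail G u u l) (h2 : 2 ≤ l.length)
    (hv : (l.map Prod.snd).Nodup) (hc : (l.map Prod.fst).Nodup) :
    IsRainbowCycle G (l.map Prod.snd).toFinset (l.map Prod.fst).toFinset := by
  have hm : 0 < l.length := by omega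
  have hlt : ∀ i, i % l.length < l.length := fun i => Nat.mod_lt i hm
  have shift : ∀ i < l.length, (i + 1) % l.length = if i + 1 = l.length then 0 else i + 1 := by
    intro i hi
    split_ifs with h'
    · rw [h', Nat.mod_self]
    · exact Nat.mod_eq_of_lt (by omega)
  refine Or.inr ⟨l.length, fun i => (l[i % l.length]'(hlt i)).2,
    fun i => (l[(i + 1) % l.length]'(hlt (i + 1))).1, h2, ?_, ?_, ?_, ?_, ?_, ?_, ?_, ?_⟩
  · rw [List.toFinset_card_of_nodup hv, List.length_map]
  · intro i; simp
  · intro i hi j hj hij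
    simp only [Set.mem_Iio] at hi hj
    have := (List.Nodup.getElem_inj_iff hv (i := i % l.length) (hi := by simpa using hlt i)
      (j := j % l.length) (hj := by simpa using hlt j)).1 (by simpa using hij)
    rwa [Nat.mod_eq_of_lt hi, Nat.mod_eq_of_lt hj] at this
  · ext x
    simp only [Finset.mem_image, Finset.mem_range, List.mem_toFinset]
    rw [List.mem_iff_getElem]
    constructor
    · rintro ⟨i, hi, rfl⟩
      exact ⟨i % l.length, by simpa using hlt i, by simp⟩
    · rintro ⟨i, hi, rfl⟩
      have hi' : i < l.length := by simpa using hi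
      exact ⟨i, hi', by simp [Nat.mod_eq_of_lt hi']⟩
  · intro i
    have : (i + l.length + 1) % l.length = (i + 1) % l.length := by
      rw [add_right_comm, Nat.add_mod_right]
    simp only [this]
  · intro i hi j hj hij
    simp only [Set.mem_Iio] at hi hj
    have := (List.Nodup.getElem_inj_iff hc (i := (i + 1) % l.length)
      (hi := by simpa using hlt (i + 1))
      (j := (j + 1) % l.length) (hj := by simpa using hlt (j + 1))).1 (by simpa using hij)
    rw [shift i hi, shift j hj] at this
    split_ifs at this <;> omega
  · ext x
    simp only [Finset.mem_image, Finset.mem_range, List.mem_toFinset]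
    rw [List.mem_iff_getElem]
    constructor
    · rintro ⟨i, hi, rfl⟩
      exact ⟨(i + 1) % l.length, by simpa using hlt (i + 1), by simp⟩
    · rintro ⟨i, hi, rfl⟩
      have hi' : i < l.length := by simpa using hi
      rcases Nat.eq_zero_or_pos i with rfl | hpos
      · refine ⟨l.length - 1, by omega, ?_⟩
        have : (l.length - 1 + 1) % l.length = 0 := by rw [Nat.sub_add_cancel hm, Nat.mod_self]
        simp [this]
      · refine ⟨i - 1, by omega, ?_⟩
        have : (i - 1 + 1) % l.length = i := by
          rw [Nat.sub_add_cancel hpos, Nat.mod_eq_of_lt hi']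
        simp [this]
  · intro i
    have hs : (i + 1) % l.length = (i % l.length + 1) % l.length := by simp
    have h3 := shift _ (hlt i)
    split_ifs at h3 with h4
    · have h5 : i % l.length = l.length - 1 := by omega
      have h6 : (i + 1) % l.length = 0 := by rw [hs, h3]
      simp only [h5, h6, h.getElem_last hm]
      exact h.adj_head hm
    · have h6 : (i + 1) % l.length = i % l.length + 1 := by rw [hs, h3]
      simp only [h6]
      exact h.adj_getElem _ (by have := hlt i; omega)

open Classical in
/-- The graph on `E` of pairs joined by at least `m` colours of `R`, together with one bridge
`p c`, `q c` for each colour `c ∈ B`. -/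
def bridgeGraph {V γ : Type*} (G : γ → SimpleGraph V) (R : Finset γ) (m : ℕ) (B : Finset γ)
    (p q : γ → V) (E : Finset V) : SimpleGraph V where
  Adj x y := x ≠ y ∧ x ∈ E ∧ y ∈ E ∧
    (m ≤ (R.filter fun c => (G c).Adj x y).card ∨ ∃ c ∈ B, s(p c, q c) = s(x, y))
  symm := ⟨by
    rintro x y ⟨h1, h2, h3, h4⟩
    refine ⟨h1.symm, h3, h2, ?_⟩
    simpa only [SimpleGraph.adj_comm _ y x, Sym2.eq_swap (a := y) (b := x)] using h4⟩
  loopless := ⟨fun x h => h.1 rfl⟩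

lemma bridgeGraph_mono {V γ : Type*} (G : γ → SimpleGraph V) (R : Finset γ) (m : ℕ)
    {B B' : Finset γ} {p q p' q' : γ → V} {E E' : Finset V} (hB : B ⊆ B') (hE : E ⊆ E')
    (hp : ∀ c ∈ B, p' c = p c) (hq : ∀ c ∈ B, q' c = q c) :
    bridgeGraph G R m B p q E ≤ bridgeGraph G R m B' p' q' E' := by
  rintro x y ⟨h1, h2, h3, h4⟩
  refine ⟨h1, hE h2, hE h3, h4.imp_right ?_⟩
  rintro ⟨c, hc, h⟩
  exact ⟨c, hB hc, by rw [hp c hc, hq c hc, h]⟩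

open Classical in
/-- A short path in the bridge graph can be coloured so as to become rainbow. -/
lemma exists_rainbow_trail_of_isPath {V γ : Type*} {G : γ → SimpleGraph V} {R : Finset γ} {m : ℕ}
    {B : Finset γ} {p q : γ → V} {E : Finset V} (hBR : Disjoint B R)
    (hB : ∀ c ∈ B, (G c).Adj (p c) (q c)) {u v : V}
    (w : (bridgeGraph G R m B p q E).Walk u v) (hw : w.IsPath) (Z : Finset γ) (hZ : Z ⊆ R)
    (hm : Z.card + w.length ≤ m) :
    ∃ l : List (γ × V), IsTrail G u v l ∧ l.map Prod.snd = w.support.tail ∧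
      (l.map Prod.fst).Nodup ∧ (∀ c ∈ l.map Prod.fst, c ∈ R ∪ B ∧ c ∉ Z) ∧
      ∀ c ∈ l.map Prod.fst, c ∈ B → s(p c, q c) ∈ w.edges := by
  induction w generalizing Z with
  | nil => exact ⟨[], rfl, by simp, by simp, by simp, by simp⟩
  | @cons a b d hab w ih =>
    rw [SimpleGraph.Walk.cons_isPath_iff] at hw
    rw [SimpleGraph.Walk.length_cons] at hm
    have hsupp : b :: w.support.tail = w.support := w.cons_tail_support
    rcases hab.2.2.2 with h | ⟨c, hc, hce⟩
    · obtain ⟨c, hc, hcZ⟩ := Finset.exists_mem_notMem_of_card_lt_card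
        (show Z.card < (R.filter fun c => (G c).Adj a b).card by omega)
      rw [Finset.mem_filter] at hc
      obtain ⟨l, h1, h2, h3, h4, h5⟩ := ih hw.1 (insert c Z)
        (Finset.insert_subset hc.1 hZ) (by rw [Finset.card_insert_of_notMem hcZ]; omega)
      refine ⟨(c, b) :: l, ⟨hc.2, h1⟩, by simp [h2, hsupp], ?_, ?_, ?_⟩
      · rw [List.map_cons, List.nodup_cons]
        exact ⟨fun h' => (h4 _ h').2 (Finset.mem_insert_self _ _), h3⟩
      · rw [List.map_cons]
        intro x hx
        rcases List.mem_cons.1 hx with rfl | hx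
        · exact ⟨Finset.mem_union_left _ hc.1, hcZ⟩
        · exact ⟨(h4 x hx).1, fun h' => (h4 x hx).2 (Finset.mem_insert_of_mem h')⟩
      · rw [List.map_cons]
        intro x hx hxB
        rcases List.mem_cons.1 hx with rfl | hx
        · exact absurd hc.1 (Finset.disjoint_left.1 hBR hxB)
        · simp [h5 x hx hxB]
    · obtain ⟨l, h1, h2, h3, h4, h5⟩ := ih hw.1 Z hZ (by omega)
      have hadj : (G c).Adj a b := by
        have := hB c hc
        rwa [← SimpleGraph.mem_edgeSet, hce] at this
      refine ⟨(c, b) :: l, ⟨hadj, h1⟩, by simp [h2, hsupp], ?_, ?_, ?_⟩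
      · rw [List.map_cons, List.nodup_cons]
        refine ⟨fun h' => hw.2 ?_, h3⟩
        have := h5 c h' hc
        rw [hce] at this
        exact w.fst_mem_support_of_mem_edges this
      · rw [List.map_cons]
        intro x hx
        rcases List.mem_cons.1 hx with rfl | hx
        · exact ⟨Finset.mem_union_right _ hc, fun h' => Finset.disjoint_left.1 hBR hc (hZ h')⟩
        · exact h4 x hx
      · rw [List.map_cons]
        intro x hx hxB
        rcases List.mem_cons.1 hx with rfl | hx
        · simp [hce]
        · simp [h5 x hx hxB]

open Classical in
/-- Bridges can be added to the hubs `D` until no further colour joins different clusters. -/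
lemma exists_bridges {V γ : Type*} [Nonempty V] (G : γ → SimpleGraph V) (R : Finset γ) (m : ℕ)
    (hm : 0 < m) (D : Finset V) (Y : Set V) (h : V → V) (hD : ∀ y ∈ Y, h y ∈ D)
    (hY : ∀ y ∈ Y, m ≤ (R.filter fun c => (G c).Adj y (h y)).card) :
    ∃ (B : Finset γ) (p q : γ → V) (lab : V → V), Disjoint B R ∧
      (∀ c ∈ B, (G c).Adj (p c) (q c) ∧ p c ∈ Y ∧ q c ∈ Y) ∧ B.card ≤ D.card ∧
      (∀ d ∈ D, ∀ d' ∈ D, lab d = lab d' →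
        (bridgeGraph G R m B p q (D ∪ B.image p ∪ B.image q)).Reachable d d') ∧
      ∀ c ∉ R ∪ B, ∀ x ∈ Y, ∀ y ∈ Y, (G c).Adj x y → lab (h x) = lab (h y) := by
  by_contra hcon
  push Not at hcon
  have key : ∀ k : ℕ, ∃ (B : Finset γ) (p q : γ → V) (lab : V → V), B.card = k ∧ Disjoint B R ∧
      (∀ c ∈ B, (G c).Adj (p c) (q c) ∧ p c ∈ Y ∧ q c ∈ Y) ∧
      B.card + (D.image lab).card ≤ D.card ∧
      (∀ d ∈ D, ∀ d' ∈ D, lab d = lab d' →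
        (bridgeGraph G R m B p q (D ∪ B.image p ∪ B.image q)).Reachable d d') := by
    intro k
    induction k with
    | zero =>
      obtain ⟨v⟩ := ‹Nonempty V›
      refine ⟨∅, fun _ => v, fun _ => v, id, rfl, by simp, by simp, by simp, ?_⟩
      rintro d - d' - rfl
      exact SimpleGraph.Reachable.refl _
    | succ k ih =>
      obtain ⟨B, p, q, lab, hk, h1, h2, h3, h4⟩ := ih
      obtain ⟨c, hc, x, hx, y, hy, hxy, hne⟩ := hcon B p q lab h1 h2 (by omega) h4
      rw [Finset.mem_union, not_or] at hc
      obtain ⟨hcR, hcB⟩ := hc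
      have hp : ∀ b ∈ B, Function.update p c x b = p b := fun b hb =>
        Function.update_of_ne (ne_of_mem_of_not_mem hb hcB) _ _
      have hq : ∀ b ∈ B, Function.update q c y b = q b := fun b hb =>
        Function.update_of_ne (ne_of_mem_of_not_mem hb hcB) _ _
      have hpi : (insert c B).image (Function.update p c x) = insert x (B.image p) := by
        rw [Finset.image_insert, Function.update_self, Finset.image_congr hp]
      have hqi : (insert c B).image (Function.update q c y) = insert y (B.image q) := by
        rw [Finset.image_insert, Function.update_self, Finset.image_congr hq]
      refine ⟨insert c B, Function.update p c x, Function.update q c y,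
        fun d => if lab d = lab (h x) then lab (h y) else lab d,
        by rw [Finset.card_insert_of_notMem hcB, hk], ?_, ?_, ?_, ?_⟩
      · exact Finset.disjoint_insert_left.2 ⟨hcR, h1⟩
      · intro b hb
        rcases Finset.mem_insert.1 hb with rfl | hb
        · simpa using ⟨hxy, hx, hy⟩
        · rw [hp b hb, hq b hb]; exact h2 b hb
      · rw [Finset.card_insert_of_notMem hcB]
        have : (D.image fun d => if lab d = lab (h x) then lab (h y) else lab d) ⊂
            D.image lab := by
          rw [Finset.ssubset_iff_of_subset]
          · refine ⟨lab (h x), Finset.mem_image_of_mem _ (hD x hx), ?_⟩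
            rw [Finset.mem_image]
            rintro ⟨d, -, hd⟩
            split_ifs at hd with h'
            · exact hne hd.symm
            · exact h' hd
          · intro z hz
            obtain ⟨d, hd, rfl⟩ := Finset.mem_image.1 hz
            split_ifs
            · exact Finset.mem_image_of_mem _ (hD y hy)
            · exact Finset.mem_image_of_mem _ hd
        have := Finset.card_lt_card this
        omega
      · rw [hpi, hqi]
        set F := bridgeGraph G R m (insert c B) (Function.update p c x) (Function.update q c y)
          (D ∪ insert x (B.image p) ∪ insert y (B.image q)) with hF
        have hmono : ∀ d ∈ D, ∀ d' ∈ D, lab d = lab d' → F.Reachable d d' := by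
          intro d hd d' hd' e
          refine (h4 d hd d' hd' e).mono
            (bridgeGraph_mono G R m (Finset.subset_insert _ _) ?_ hp hq)
          exact Finset.union_subset_union (Finset.union_subset_union le_rfl
            (Finset.subset_insert _ _)) (Finset.subset_insert _ _)
        have hhub : ∀ z ∈ Y, z ∈ D ∪ insert x (B.image p) ∪ insert y (B.image q) →
            F.Reachable z (h z) := by
          intro z hz hz'
          refine SimpleGraph.Adj.reachable ⟨?_, hz', by simp [hD z hz], Or.inl (hY z hz)⟩
          obtain ⟨b, hb⟩ := Finset.card_pos.1 (hm.trans_le (hY z hz))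
          exact (Finset.mem_filter.1 hb).2.ne
        have hbr : F.Reachable (h x) (h y) := by
          refine ((hhub x hx (by simp)).symm.trans ?_).trans (hhub y hy (by simp))
          exact SimpleGraph.Adj.reachable ⟨hxy.ne, by simp, by simp,
            Or.inr ⟨c, by simp, by simp⟩⟩
        intro d hd d' hd' e
        dsimp only at e
        split_ifs at e with e1 e2 e2
        · exact hmono d hd d' hd' (e1.trans e2.symm)
        · exact (hmono d hd _ (hD x hx) e1).trans (hbr.trans (hmono _ (hD y hy) d' hd' e))
        · exact ((hmono d hd _ (hD y hy) e).trans hbr.symm).trans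
            (hmono _ (hD x hx) d' hd' e2.symm)
        · exact hmono d hd d' hd' e
  obtain ⟨B, p, q, lab, hk, -, -, h3, -⟩ := key (D.card + 1)
  omega

open Classical in
/-- If every vertex of `Y` is joined by many colours of `R` to a hub in `D`, then there are small
sets `C` of colours and `E` of vertices such that all vertices of `Y` with the same label are
connected by a rainbow trail through `E` with colours in `C`, and the other colours preserve
labels. -/
lemma exists_connector {V γ : Type*} [Nonempty V] (G : γ → SimpleGraph V) (R : Finset γ) (m : ℕ)
    (D : Finset V) (hm : 3 * D.card + 1 ≤ m) (Y : Set V) (h : V → V) (hD : ∀ y ∈ Y, h y ∈ D)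
    (hY : ∀ y ∈ Y, m ≤ (R.filter fun c => (G c).Adj y (h y)).card) :
    ∃ (C : Finset γ) (E : Finset V) (lab : V → V), C.card ≤ R.card + D.card ∧ R ⊆ C ∧
      E.card ≤ 3 * D.card ∧ (∀ z ∈ E, z ∈ D ∨ z ∈ Y) ∧
      (∀ c ∉ C, ∀ x ∈ Y, ∀ y ∈ Y, (G c).Adj x y → lab x = lab y) ∧
      ∀ a ∈ Y, ∀ b ∈ Y, lab a = lab b → ∃ l : List (γ × V), IsTrail G a b l ∧
        (a :: l.map Prod.snd).Nodup ∧ (∀ x ∈ a :: l.map Prod.snd, x ∈ E ∨ x = a ∨ x = b) ∧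
        (l.map Prod.fst).Nodup ∧ ∀ c ∈ l.map Prod.fst, c ∈ C := by
  obtain ⟨B, p, q, lab, h1, h2, h3, h4, h5⟩ := exists_bridges G R m (by omega) D Y h hD hY
  set E := D ∪ B.image p ∪ B.image q with hE
  have hEcard : E.card ≤ 3 * D.card := by
    have e1 := Finset.card_union_le (D ∪ B.image p) (B.image q)
    have e2 := Finset.card_union_le D (B.image p)
    have e3 : (B.image p).card ≤ B.card := Finset.card_image_le
    have e4 : (B.image q).card ≤ B.card := Finset.card_image_le
    rw [hE]
    omega
  refine ⟨R ∪ B, E, lab ∘ h, (Finset.card_union_le _ _).trans (by omega),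
    Finset.subset_union_left, hEcard, ?_, h5, ?_⟩
  · intro z hz
    simp only [hE, Finset.mem_union, Finset.mem_image] at hz
    rcases hz with (hz | ⟨c, hc, rfl⟩) | ⟨c, hc, rfl⟩
    · exact Or.inl hz
    · exact Or.inr (h2 c hc).2.1
    · exact Or.inr (h2 c hc).2.2
  · intro a ha b hb hab
    set F := bridgeGraph G R m B p q (E ∪ {a, b}) with hF
    have hhub : ∀ z ∈ Y, z ∈ E ∪ {a, b} → F.Reachable z (h z) := by
      intro z hz hz'
      refine SimpleGraph.Adj.reachable ⟨?_, hz', by simp [hE, hD z hz], Or.inl (hY z hz)⟩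
      obtain ⟨c, hc⟩ := Finset.card_pos.1
        ((show 0 < m by omega).trans_le (hY z hz))
      exact (Finset.mem_filter.1 hc).2.ne
    have hreach : F.Reachable a b :=
      ((hhub a ha (by simp)).trans ((h4 _ (hD a ha) _ (hD b hb) hab).mono
        (bridgeGraph_mono G R m subset_rfl Finset.subset_union_left (fun _ _ => rfl)
          fun _ _ => rfl))).trans (hhub b hb (by simp)).symm
    obtain ⟨w, hw⟩ := hreach.exists_isPath
    have hsupp : ∀ x ∈ w.support, x ∈ E ∪ {a, b} := by
      have : ∀ (a' b' : V) (w : F.Walk a' b'), a' ∈ E ∪ {a, b} →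
          ∀ x ∈ w.support, x ∈ E ∪ {a, b} := by
        intro a' b' w
        induction w with
        | nil => intro h x hx; simp at hx; rwa [hx]
        | cons hadj w ih =>
          intro h x hx
          rw [SimpleGraph.Walk.support_cons, List.mem_cons] at hx
          rcases hx with rfl | hx
          · exact h
          · exact ih hadj.2.2.1 x hx
      exact this a b w (by simp)
    have hlen : w.length + 1 ≤ E.card + 2 := by
      rw [← w.length_support, ← List.toFinset_card_of_nodup hw.support_nodup]
      refine (Finset.card_le_card fun x hx => hsupp x (List.mem_toFinset.1 hx)).trans ?_
      exact (Finset.card_union_le _ _).trans (Nat.add_le_add_left Finset.card_le_two _)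
    obtain ⟨l, l1, l2, l3, l4, -⟩ := exists_rainbow_trail_of_isPath h1
      (fun c hc => (h2 c hc).1) w hw ∅ (by simp) (by simp; omega)
    have l5 : a :: l.map Prod.snd = w.support := by rw [l2, w.cons_tail_support]
    refine ⟨l, l1, l5 ▸ hw.support_nodup, ?_, l3, fun c hc => (l4 c hc).1⟩
    intro x hx
    rw [l5] at hx
    simpa only [Finset.mem_union, Finset.mem_insert, Finset.mem_singleton] using hsupp x hx

/-- Closing a path `f 0, …, f (k + 2)` to a rainbow cycle, after replacing its two end vertices
by `a` and `b`, which are connected by the trail `l`. -/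
lemma exists_isRainbowCycle_of_trail {n : ℕ} {γ : Type*} [DecidableEq γ]
    {G : γ → SimpleGraph (Fin n)} (k : ℕ) (f : ℕ → Fin n) (col : ℕ → γ)
    (hf : Set.InjOn f (Set.Iio (k + 3))) (hcol : Set.InjOn col (Set.Iio (k + 2)))
    (hadj : ∀ i < k + 2, (G (col i)).Adj (f i) (f (i + 1))) {a b : Fin n}
    (ha : (G (col 0)).Adj (f 1) a) (hb : (G (col (k + 1))).Adj (f (k + 1)) b)
    {l : List (γ × Fin n)} (hl : IsTrail G b a l) (hnd : (b :: l.map Prod.snd).Nodup)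
    (hdisj : ∀ x ∈ b :: l.map Prod.snd, ∀ i < k + 3, x ≠ f i)
    (hcnd : (l.map Prod.fst).Nodup) (hcdisj : ∀ c ∈ l.map Prod.fst, ∀ i < k + 2, c ≠ col i) :
    IsRainbowCycle G ((Finset.Ico 1 (k + 2)).image f ∪ (b :: l.map Prod.snd).toFinset)
      ((Finset.range (k + 2)).image col ∪ (l.map Prod.fst).toFinset) := by
  have hmid := isTrail_map_range (G := G) f col 1 k
    fun i hi => by simpa [add_comm, add_assoc, add_left_comm] using hadj (1 + i) (by omega)
  set M := (List.range k).map fun i => (col (1 + i), f (1 + i + 1)) with hM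
  set L := M ++ (col (k + 1), b) :: (l ++ [(col 0, f 1)]) with hL
  have hLt : IsTrail G (f 1) (f 1) L := by
    refine hmid.append ⟨by rwa [add_comm 1 k], hl.append ⟨ha.symm, rfl⟩⟩
  have hMs : M.map Prod.snd = (List.range k).map fun i => f (1 + i + 1) := by simp [hM]
  have hMf : M.map Prod.fst = (List.range k).map fun i => col (1 + i) := by simp [hM]
  have hLs : L.map Prod.snd = (List.range k).map (fun i => f (1 + i + 1)) ++
      ((b :: l.map Prod.snd) ++ [f 1]) := by simp [hL, hMs]
  have hLf : L.map Prod.fst = (List.range k).map (fun i => col (1 + i)) ++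
      ([col (k + 1)] ++ (l.map Prod.fst ++ [col 0])) := by simp [hL, hMf]
  have finj : ∀ i j, i < k + 3 → j < k + 3 → f i = f j → i = j := fun i j hi hj => hf hi hj
  have cinj : ∀ i j, i < k + 2 → j < k + 2 → col i = col j → i = j := fun i j hi hj => hcol hi hj
  have := hLt.isRainbowCycle (by simp [hL]; omega) ?_ ?_
  · convert this using 1
    · rw [hLs]
      ext x
      simp only [Finset.mem_union, Finset.mem_image, Finset.mem_Ico, List.mem_toFinset,
        List.mem_append, List.mem_map (l := List.range k), List.mem_range, List.mem_singleton]
      constructor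
      · rintro (⟨i, hi, rfl⟩ | h)
        · rcases Nat.lt_or_ge 1 i with h | h
          · exact Or.inl ⟨i - 2, by omega, by congr 1; omega⟩
          · obtain rfl : i = 1 := by omega
            exact Or.inr (Or.inr rfl)
        · exact Or.inr (Or.inl h)
      · rintro (⟨i, hi, rfl⟩ | h | rfl)
        · exact Or.inl ⟨1 + i + 1, by omega, rfl⟩
        · exact Or.inr h
        · exact Or.inl ⟨1, by omega, rfl⟩
    · rw [hLf]
      ext x
      simp only [Finset.mem_union, Finset.mem_image, Finset.mem_range, List.mem_toFinset,
        List.mem_append, List.mem_map (l := List.range k), List.mem_range, List.mem_singleton]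
      constructor
      · rintro (⟨i, hi, rfl⟩ | h)
        · rcases Nat.eq_zero_or_pos i with rfl | h
          · exact Or.inr (Or.inr (Or.inr rfl))
          · rcases Nat.lt_or_ge k i with h' | h'
            · obtain rfl : i = k + 1 := by omega
              exact Or.inr (Or.inl rfl)
            · exact Or.inl ⟨i - 1, by omega, by congr 1; omega⟩
        · exact Or.inr (Or.inr (Or.inl h))
      · rintro (⟨i, hi, rfl⟩ | rfl | h | rfl)
        · exact Or.inl ⟨1 + i, by omega, rfl⟩
        · exact Or.inl ⟨k + 1, by omega, rfl⟩
        · exact Or.inr h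
        · exact Or.inl ⟨0, by omega, rfl⟩
  · rw [hLs]
    refine List.nodup_append.2 ⟨?_, List.nodup_append.2 ⟨hnd, by simp, ?_⟩, ?_⟩
    · refine List.Nodup.map_on ?_ List.nodup_range
      intro i hi j hj e
      simp only [List.mem_range] at hi hj
      have := finj _ _ (by omega) (by omega) e
      omega
    · intro x hx y hy
      obtain rfl : y = f 1 := by simpa using hy
      exact hdisj x hx 1 (by omega)
    · intro x hx y hy e
      subst e
      obtain ⟨i, hi, rfl⟩ := List.mem_map.1 hx
      rw [List.mem_range] at hi
      rcases List.mem_append.1 hy with hy | hy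
      · exact hdisj _ hy (1 + i + 1) (by omega) rfl
      · have := finj _ _ (by omega) (by omega) (List.mem_singleton.1 hy)
        omega
  · rw [hLf]
    refine List.nodup_append.2 ⟨?_, List.nodup_append.2 ⟨by simp, List.nodup_append.2
      ⟨hcnd, by simp, ?_⟩, ?_⟩, ?_⟩
    · refine List.Nodup.map_on ?_ List.nodup_range
      intro i hi j hj e
      simp only [List.mem_range] at hi hj
      have := cinj _ _ (by omega) (by omega) e
      omega
    · intro x hx y hy
      obtain rfl : y = col 0 := by simpa using hy
      exact hcdisj x hx 0 (by omega)
    · intro x hx y hy e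
      subst e
      obtain rfl := List.mem_singleton.1 hx
      rcases List.mem_append.1 hy with hy | hy
      · exact hcdisj _ hy _ (by omega) rfl
      · have := cinj _ _ (by omega) (by omega) (List.mem_singleton.1 hy)
        omega
    · intro x hx y hy e
      subst e
      obtain ⟨i, hi, rfl⟩ := List.mem_map.1 hx
      rw [List.mem_range] at hi
      rcases List.mem_append.1 hy with hy | hy
      · have := cinj _ _ (by omega) (by omega) (List.mem_singleton.1 hy)
        omega
      · rcases List.mem_append.1 hy with hy | hy
        · exact hcdisj _ hy (1 + i) (by omega) rfl
        · have := cinj _ _ (by omega) (by omega) (List.mem_singleton.1 hy)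
          omega

/-- The vertex `v` is incident to edges of at least two colours. -/
def IsMulticoloured {V γ : Type*} (G : γ → SimpleGraph V) (v : V) : Prop :=
  ∃ c₁ c₂ : γ, c₁ ≠ c₂ ∧ (∃ w, (G c₁).Adj v w) ∧ ∃ w, (G c₂).Adj v w

lemma isMulticoloured_of_two_le_card {V γ : Type*} {G : γ → SimpleGraph V} {R : Finset γ} {v : V}
    [DecidablePred fun c => ∃ w, (G c).Adj v w]
    (h : 2 ≤ (R.filter fun c => ∃ w, (G c).Adj v w).card) : IsMulticoloured G v := by
  obtain ⟨a, ha, b, hb, hab⟩ := Finset.one_lt_card.1 h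
  exact ⟨a, b, hab, (Finset.mem_filter.1 ha).2, (Finset.mem_filter.1 hb).2⟩

open Classical in
lemma isMulticoloured_of_multiple_neighbour {V γ : Type*} {G : γ → SimpleGraph V} {R : Finset γ}
    {v y : V} (h : 2 ≤ (R.filter fun c => (G c).Adj v y).card) : IsMulticoloured G v :=
  isMulticoloured_of_two_le_card (R := R) <| h.trans <| Finset.card_le_card <|
    Finset.monotone_filter_right _ fun _ _ hc => ⟨y, hc⟩

open Classical in
/-- There are bounded sets `R` of colours and `D` of hubs such that, in each colour outside `R`,
every multicoloured vertex seeing that colour has many neighbours that are joined to a hub by at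
least `m` colours of `R`. -/
lemma exists_hubs {V γ : Type*} [Fintype V] [Nonempty V] [Fintype γ] (G : γ → SimpleGraph V)
    {δ : ℝ} (hδ : 0 < δ)
    (hdeg : ∀ v, IsMulticoloured G v → ∀ c, (∃ w, (G c).Adj v w) →
      δ * (Fintype.card V : ℝ) ≤ ((Finset.univ.filter ((G c).Adj v)).card : ℝ))
    (m K : ℕ) (hm : 2 ≤ m) (hK : 2 ≤ K) (hmK : 2 * (m : ℝ) ≤ δ * K) :
    ∃ (R : Finset γ) (D : Finset V) (Y : Set V) (h : V → V),
      δ * (R.card : ℝ) ≤ 4 * K ∧ δ ^ 2 * (D.card : ℝ) ≤ 8 ∧ (∀ y ∈ Y, h y ∈ D) ∧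
      (∀ y ∈ Y, m ≤ (R.filter fun c => (G c).Adj y (h y)).card) ∧
      (∀ d ∈ D, IsMulticoloured G d) ∧
      ∀ v, IsMulticoloured G v → ∀ c ∉ R, (∃ w, (G c).Adj v w) →
        δ * (Fintype.card V : ℝ) / 2 ≤
          ((Finset.univ.filter fun y => (G c).Adj v y ∧ y ∈ Y).card : ℝ) := by
  set N : ℝ := (Fintype.card V : ℝ) with hN
  have hNpos : 0 < N := by rw [hN]; exact_mod_cast Fintype.card_pos
  have hKpos : (0 : ℝ) < K := by exact_mod_cast (show 0 < K by omega)
  obtain ⟨R, hR1, hR2⟩ := exists_greedy_cover (fun (v : V) (c : γ) => ∃ w, (G c).Adj v w) K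
    (δ * N / 4)
  obtain ⟨D, hD1, hD2⟩ := exists_greedy_cover
    (fun (v d : V) => m ≤ (R.filter fun c => (G c).Adj v d).card) 1 (δ ^ 2 * N / 8)
  set Y : Set V := {y | ∃ d ∈ D, m ≤ (R.filter fun c => (G c).Adj y d).card} with hY
  choose! h hh using fun (y : V) (hy : y ∈ Y) => hy
  have hmulti : ∀ y ∈ Y, IsMulticoloured G (h y) := fun y hy => by
    refine isMulticoloured_of_multiple_neighbour (R := R) (y := y) (hm.trans ?_)
    simpa only [SimpleGraph.adj_comm _ (h y) y] using (hh y hy).2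
  refine ⟨R, D.filter (IsMulticoloured G), Y, h, ?_, ?_,
    fun y hy => Finset.mem_filter.2 ⟨(hh y hy).1, hmulti y hy⟩, fun y hy => (hh y hy).2,
    fun d hd => (Finset.mem_filter.1 hd).2, ?_⟩
  · rw [← hN] at hR1
    refine le_of_mul_le_mul_right ?_ hNpos
    linarith
  · have h1 : (((D.filter (IsMulticoloured G)).card : ℕ) : ℝ) ≤ D.card := by
      exact_mod_cast Finset.card_filter_le _ _
    have h2 : δ ^ 2 * (D.card : ℝ) ≤ 8 := by
      rw [← hN] at hD1
      refine le_of_mul_le_mul_right ?_ hNpos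
      push_cast at hD1
      linarith
    exact (mul_le_mul_of_nonneg_left h1 (by positivity)).trans h2
  · set X : Finset V := Finset.univ.filter fun u =>
      K ≤ (R.filter fun c => ∃ w, (G c).Adj u w).card ∧ u ∉ Y with hX
    have hXcard : (X.card : ℝ) ≤ δ * N / 4 := by
      have h1 : ∀ u ∈ X, δ * N / 2 ≤
          ((Finset.univ.filter fun y => m ≤ (R.filter fun c => (G c).Adj u y).card).card : ℝ) := by
        intro u hu
        have hu' := (Finset.mem_filter.1 hu).2.1
        have h2 := mul_le_card_multiple_neighbours G R u K m (δ * N) hu' fun c _ hc =>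
          hdeg u (isMulticoloured_of_two_le_card (R := R) (hK.trans hu')) c hc
        rw [← hN] at h2
        refine le_of_mul_le_mul_left ?_ hKpos
        nlinarith
      have h2 : (X.card : ℝ) * (δ * N / 2) ≤ ∑ u ∈ X,
          ((Finset.univ.filter fun y => m ≤ (R.filter fun c => (G c).Adj u y).card).card : ℝ) := by
        rw [← nsmul_eq_mul]
        exact Finset.card_nsmul_le_sum _ _ _ h1
      have h3 : ∑ u ∈ X,
          (Finset.univ.filter fun y => m ≤ (R.filter fun c => (G c).Adj u y).card).card =
          ∑ d : V, (X.filter fun u => m ≤ (R.filter fun c => (G c).Adj u d).card).card :=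
        Finset.sum_card_bipartiteAbove_eq_sum_card_bipartiteBelow
          (fun u d => m ≤ (R.filter fun c => (G c).Adj u d).card)
      have h4 : ∀ d : V,
          ((X.filter fun u => m ≤ (R.filter fun c => (G c).Adj u d).card).card : ℝ) ≤
            δ ^ 2 * N / 8 := by
        intro d
        by_cases hd : d ∈ D
        · rw [Finset.filter_eq_empty_iff.2]
          · simp only [Finset.card_empty, Nat.cast_zero]; positivity
          · intro u hu hud
            exact (Finset.mem_filter.1 hu).2.2 ⟨d, hd, hud⟩
        · refine le_trans ?_ (hD2 d hd)
          refine Nat.cast_le.2 (Finset.card_le_card fun u hu => ?_)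
          rw [Finset.mem_filter] at hu
          refine Finset.mem_filter.2 ⟨Finset.mem_univ _, hu.2, ?_⟩
          rw [Nat.lt_one_iff, Finset.card_eq_zero, Finset.filter_eq_empty_iff]
          intro d' hd' hud'
          exact (Finset.mem_filter.1 hu.1).2.2 ⟨d', hd', hud'⟩
      have h5 : (X.card : ℝ) * (δ * N / 2) ≤ N * (δ ^ 2 * N / 8) := by
        refine h2.trans ?_
        rw [← Nat.cast_sum, h3, Nat.cast_sum]
        refine (Finset.sum_le_card_nsmul _ _ _ fun d _ => h4 d).trans ?_
        rw [nsmul_eq_mul, Finset.card_univ]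
      have h6 : (0 : ℝ) < δ * N / 2 := by positivity
      refine le_of_mul_le_mul_right ?_ h6
      linarith [show δ * N / 4 * (δ * N / 2) = N * (δ ^ 2 * N / 8) by ring]
    intro v hv c hc hvc
    have h1 := hdeg v hv c hvc
    have h2 : ((Finset.univ.filter fun a => (∃ w, (G c).Adj a w) ∧
        (R.filter fun c => ∃ w, (G c).Adj a w).card < K).card : ℝ) ≤ δ * N / 4 := by
      convert hR2 c hc
    have h3 : (Finset.univ.filter ((G c).Adj v)).card ≤
        (Finset.univ.filter fun y => (G c).Adj v y ∧ y ∈ Y).card +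
        (Finset.univ.filter fun a => (∃ w, (G c).Adj a w) ∧
          (R.filter fun c => ∃ w, (G c).Adj a w).card < K).card + X.card := by
      refine (Finset.card_le_card ?_).trans ((Finset.card_union_le _ _).trans
        (Nat.add_le_add_right (Finset.card_union_le _ _) _))
      intro y hy
      have hy' : (G c).Adj v y := (Finset.mem_filter.1 hy).2
      simp only [Finset.mem_union, Finset.mem_filter, Finset.mem_univ, true_and, hX]
      by_cases h4 : y ∈ Y
      · exact Or.inl (Or.inl ⟨hy', h4⟩)
      · rcases Nat.lt_or_ge (R.filter fun c => ∃ w, (G c).Adj y w).card K with h5 | h5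
        · exact Or.inl (Or.inr ⟨⟨v, hy'.symm⟩, h5⟩)
        · exact Or.inr ⟨h5, h4⟩
    have h3' : ((Finset.univ.filter ((G c).Adj v)).card : ℝ) ≤
        ((Finset.univ.filter fun y => (G c).Adj v y ∧ y ∈ Y).card : ℝ) +
        ((Finset.univ.filter fun a => (∃ w, (G c).Adj a w) ∧
          (R.filter fun c => ∃ w, (G c).Adj a w).card < K).card : ℝ) + X.card := by
      exact_mod_cast h3
    have h4 : δ * N / 2 ≤ ((Finset.univ.filter fun y => (G c).Adj v y ∧ y ∈ Y).card : ℝ) := by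
      linarith
    convert h4

/-- The subgraph that keeps, among the edges with colour outside `C` and no end in `E`, those
inside `Y` and those whose ends both see a single colour. -/
def absorbingSubgraph {V γ : Type*} (G : γ → SimpleGraph V) (C : Finset γ) (E : Finset V)
    (Y : Set V) (c : γ) : SimpleGraph V where
  Adj x y := (G c).Adj x y ∧ c ∉ C ∧ x ∉ E ∧ y ∉ E ∧
    ((x ∈ Y ∧ y ∈ Y) ∨ (¬ IsMulticoloured G x ∧ ¬ IsMulticoloured G y))
  symm := ⟨fun _ _ ⟨h1, h2, h3, h4, h5⟩ =>
    ⟨h1.symm, h2, h4, h3, h5.imp And.symm And.symm⟩⟩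
  loopless := ⟨fun _ h => h.1.ne rfl⟩

open Classical in
lemma absorption_subgraph_of_le_one {δ : ℝ} (hδ : 0 < δ) (hδ1 : δ ≤ 1) (n : ℕ)
    (hn : 96 / δ ^ 3 < n) (γ : Type*) [Fintype γ] [DecidableEq γ] (G : γ → SimpleGraph (Fin n))
    (hne : ∀ c : γ, (G c).edgeSet.Nonempty)
    (hdeg : ∀ v, IsMulticoloured G v → ∀ c, (∃ w, (G c).Adj v w) →
      δ * (Fintype.card (Fin n) : ℝ) ≤ ((Finset.univ.filter ((G c).Adj v)).card : ℝ)) :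
    ∃ (W : Finset (Fin n)) (G' : γ → SimpleGraph (Fin n)),
      (∀ c, G' c ≤ G c) ∧
      (∀ c u v, (G' c).Adj u v → u ∈ W ∧ v ∈ W) ∧
      (((Finset.univ \ W).card : ℝ) < 2000 / δ ^ 4) ∧
      ((({c : γ | (G' c).edgeSet = ∅} : Set γ).ncard : ℝ) < 2000 / δ ^ 4) ∧
      ∀ (s : Finset (Fin n)) (cs : Finset γ), IsRainbowPath G' s cs → 3 ≤ s.card →
        ∀ S : Finset (Fin n), S ⊆ W \ s → ((s ∪ S).card : ℝ) ≤ δ * n / 4 →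
          ∃ (s' : Finset (Fin n)) (cs' : Finset γ),
            IsRainbowCycle G s' cs' ∧ Disjoint s' S ∧
            ↑cs ⊆ (↑cs' : Set γ) ∧
            (↑cs' : Set γ) ⊆ ↑cs ∪ {c : γ | (G' c).edgeSet = ∅} := by
  have hn' : (0 : ℝ) < n := lt_trans (by positivity) hn
  have hn0 : 0 < n := by exact_mod_cast hn'
  have : Nonempty (Fin n) := ⟨⟨0, hn0⟩⟩
  set m : ℕ := ⌈24 / δ ^ 2⌉₊ + 2 with hm
  set K : ℕ := ⌈2 * (m : ℝ) / δ⌉₊ with hK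
  have hm_low : 24 / δ ^ 2 + 2 ≤ (m : ℝ) := by
    rw [hm]; push_cast; linarith [Nat.le_ceil (24 / δ ^ 2)]
  have hm_up : (m : ℝ) * δ ^ 2 ≤ 27 := by
    have h1 := Nat.ceil_lt_add_one (show 0 ≤ 24 / δ ^ 2 by positivity)
    have h2 : (m : ℝ) ≤ 24 / δ ^ 2 + 3 := by rw [hm]; push_cast; linarith
    have h3 : (24 / δ ^ 2 + 3) * δ ^ 2 = 24 + 3 * δ ^ 2 := by field_simp
    nlinarith [sq_nonneg δ]
  have hmK : 2 * (m : ℝ) ≤ δ * K := by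
    have := Nat.le_ceil (2 * (m : ℝ) / δ)
    rw [div_le_iff₀ hδ] at this
    linarith
  have hK_up : (K : ℝ) * δ ^ 3 ≤ 55 := by
    have h1 := (Nat.ceil_lt_add_one (show 0 ≤ 2 * (m : ℝ) / δ by positivity)).le
    have h2 : (2 * (m : ℝ) / δ + 1) * δ ^ 3 = 2 * (m * δ ^ 2) + δ ^ 3 := by field_simp
    have h3 : δ ^ 3 ≤ 1 := pow_le_one₀ hδ.le hδ1
    have h4 := mul_le_mul_of_nonneg_right h1 (show 0 ≤ δ ^ 3 by positivity)
    rw [← hK] at h4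
    linarith
  have hK2 : 2 ≤ K := by
    have : (2 : ℝ) ≤ K := by
      have h1 : (2 : ℝ) ≤ m := by
        rw [hm]; push_cast; linarith [Nat.cast_nonneg (α := ℝ) ⌈24 / δ ^ 2⌉₊]
      nlinarith [Nat.cast_nonneg (α := ℝ) K]
    exact_mod_cast this
  obtain ⟨R, D, Y, h, hRcard, hDcard, hYD, hYm, hDmul, hbig⟩ :=
    exists_hubs G hδ hdeg m K (by omega) hK2 hmK
  rw [Fintype.card_fin] at hbig
  have hδ2 : (0 : ℝ) < δ ^ 2 := by positivity
  have hD8 : (D.card : ℝ) ≤ 8 / δ ^ 2 := by rw [le_div_iff₀ hδ2]; linarith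
  obtain ⟨C, E, lab, hCcard, hRC, hEcard, hED, hlab, hconn⟩ :=
    exists_connector G R m D (by
      have h1 : (3 * D.card + 1 : ℝ) ≤ m := by
        have : 24 / δ ^ 2 = 3 * (8 / δ ^ 2) := by ring
        linarith
      exact_mod_cast h1) Y h hYD hYm
  have hE24 : (E.card : ℝ) ≤ 24 / δ ^ 2 := by
    have h1 : (E.card : ℝ) ≤ 3 * D.card := by exact_mod_cast hEcard
    have : 24 / δ ^ 2 = 3 * (8 / δ ^ 2) := by ring
    linarith
  have hYmul : ∀ y ∈ Y, IsMulticoloured G y := fun y hy =>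
    isMulticoloured_of_multiple_neighbour (R := R) (y := h y) (le_trans (by omega) (hYm y hy))
  have hEmul : ∀ z ∈ E, IsMulticoloured G z := fun z hz => (hED z hz).elim (hDmul z) (hYmul z)
  have hEn : (E.card : ℝ) < δ * n / 4 := by
    have h1 : 24 / δ ^ 2 = δ * (96 / δ ^ 3) / 4 := by field_simp; norm_num
    have := mul_lt_mul_of_pos_left hn hδ
    linarith
  have hex : ∀ v, IsMulticoloured G v → ∀ c ∉ C, (∃ w, (G c).Adj v w) → ∀ Q : Finset (Fin n),
      (Q.card : ℝ) ≤ δ * n / 4 → ∃ y, (G c).Adj v y ∧ y ∈ Y ∧ y ∉ E ∧ y ∉ Q := by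
    intro v hv c hc hvc Q hQ
    have h1 := hbig v hv c (fun h' => hc (hRC h')) hvc
    have h2 : ((E ∪ Q).card : ℝ) ≤ E.card + Q.card := by exact_mod_cast Finset.card_union_le _ _
    have h3 : (E ∪ Q).card < (Finset.univ.filter fun y => (G c).Adj v y ∧ y ∈ Y).card := by
      have : ((E ∪ Q).card : ℝ) <
          ((Finset.univ.filter fun y => (G c).Adj v y ∧ y ∈ Y).card : ℝ) := by linarith
      exact_mod_cast this
    obtain ⟨y, hy, hy'⟩ := Finset.exists_mem_notMem_of_card_lt_card h3
    rw [Finset.mem_union, not_or] at hy'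
    have hy := (Finset.mem_filter.1 hy).2
    exact ⟨y, hy.1, hy.2, hy'.1, hy'.2⟩
  set G' := absorbingSubgraph G C E Y with hG'
  have hmiss : ∀ c, (G' c).edgeSet = ∅ ↔ c ∈ C := by
    intro c
    constructor
    · intro hc
      by_contra hcC
      obtain ⟨e, he⟩ := hne c
      induction e using Sym2.ind with | _ u v => ?_
      rw [SimpleGraph.mem_edgeSet] at he
      have hedge : ∀ x y, ¬ (G' c).Adj x y := fun x y hxy => by
        have : s(x, y) ∈ (G' c).edgeSet := hxy
        simp [hc] at this
      have hno : ∀ x, IsMulticoloured G x → ∀ y, ¬ (G c).Adj x y := by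
        intro x hx y hxy
        obtain ⟨a, ha, haY, haE, -⟩ := hex x hx c hcC ⟨y, hxy⟩ ∅ (by simp; positivity)
        obtain ⟨b, hb, hbY, hbE, -⟩ := hex a (hYmul a haY) c hcC ⟨x, ha.symm⟩ ∅
          (by simp; positivity)
        exact hedge a b ⟨hb, hcC, haE, hbE, Or.inl ⟨haY, hbY⟩⟩
      have hu : ¬ IsMulticoloured G u := fun hu => hno u hu v he
      have hv : ¬ IsMulticoloured G v := fun hv => hno v hv u he.symm
      exact hedge u v ⟨he, hcC, fun h' => hu (hEmul u h'), fun h' => hv (hEmul v h'),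
        Or.inr ⟨hu, hv⟩⟩
    · intro hc
      refine Set.eq_empty_of_forall_notMem fun e => ?_
      induction e using Sym2.ind with | _ u v => ?_
      exact fun he => (show c ∉ C from he.2.1) hc
  have hmissSet : {c : γ | (G' c).edgeSet = ∅} = (C : Set γ) := Set.ext hmiss
  refine ⟨Eᶜ, G', fun c x y hxy => hxy.1, fun c u v huv =>
    ⟨Finset.mem_compl.2 huv.2.2.1, Finset.mem_compl.2 huv.2.2.2.1⟩, ?_⟩
  rw [hmissSet]
  refine ⟨?_, ?_, ?_⟩
  · rw [← Finset.compl_eq_univ_sdiff, compl_compl, lt_div_iff₀ (by positivity)]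
    rw [le_div_iff₀ hδ2] at hE24
    have h1 : δ ^ 2 ≤ 1 := pow_le_one₀ hδ.le hδ1
    have h2 : (E.card : ℝ) * δ ^ 4 = (E.card * δ ^ 2) * δ ^ 2 := by ring
    nlinarith
  · rw [Set.ncard_coe_finset, lt_div_iff₀ (by positivity)]
    have h1 : (C.card : ℝ) ≤ R.card + D.card := by exact_mod_cast hCcard
    have h2 : (R.card : ℝ) * δ ^ 4 ≤ 220 := by
      have := mul_le_mul_of_nonneg_right hRcard (show 0 ≤ δ ^ 3 by positivity)
      have e : (R.card : ℝ) * δ ^ 4 = δ * R.card * δ ^ 3 := by ring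
      linarith
    have h3 : (D.card : ℝ) * δ ^ 4 ≤ 8 := by
      have h4 : δ ^ 2 ≤ 1 := pow_le_one₀ hδ.le hδ1
      have e : (D.card : ℝ) * δ ^ 4 = (δ ^ 2 * D.card) * δ ^ 2 := by ring
      nlinarith
    have := mul_le_mul_of_nonneg_right h1 (show 0 ≤ δ ^ 4 by positivity)
    linarith
  · rintro s cs ⟨k', f, col, -, hks, hf, hfs, hcol, hcols, hadj⟩ hs S hS hcard
    obtain ⟨k, rfl⟩ : ∃ k, k' = k + 3 := ⟨k' - 3, by omega⟩
    simp only [show k + 3 - 1 = k + 2 by omega] at hcol hcols hadj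
    have hmulf : ∀ i < k + 1, IsMulticoloured G (f (i + 1)) := fun i hi =>
      ⟨col i, col (i + 1), fun e => by
        have := hcol (by simp; omega) (by simp; omega) e
        omega, ⟨f i, (hadj i (by omega)).1.symm⟩, ⟨f (i + 2), (hadj (i + 1) (by omega)).1⟩⟩
    have hYf : ∀ i < k + 2, f i ∈ Y ∧ f (i + 1) ∈ Y := by
      intro i hi
      rcases (hadj i hi).2.2.2.2 with h' | h'
      · exact h'
      · rcases Nat.lt_or_ge i (k + 1) with h1 | h1
        · exact absurd (hmulf i h1) h'.2
        · obtain ⟨j, rfl⟩ : ∃ j, i = j + 1 := ⟨i - 1, by omega⟩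
          exact absurd (hmulf j (by omega)) h'.1
    have hlabf : ∀ i < k + 3, lab (f i) = lab (f 0) := by
      intro i
      induction i with
      | zero => intro; rfl
      | succ i ih =>
        intro hi
        rw [← ih (by omega)]
        exact (hlab (col i) (hadj i (by omega)).2.1 _ (hYf i (by omega)).1 _
          (hYf i (by omega)).2 (hadj i (by omega)).1).symm
    have hfin : ∀ i < k + 3, f i ∈ s := fun i hi => by
      rw [← hfs]; exact Finset.mem_image_of_mem _ (Finset.mem_range.2 hi)
    have hfE : ∀ i < k + 3, f i ∉ E := by
      intro i hi
      rcases Nat.lt_or_ge i (k + 2) with h1 | h1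
      · exact (hadj i h1).2.2.1
      · obtain rfl : i = k + 1 + 1 := by omega
        exact (hadj (k + 1) (by omega)).2.2.2.1
    obtain ⟨a, ha, haY, haE, haQ⟩ := hex (f 1) (hmulf 0 (by omega)) (col 0)
      (hadj 0 (by omega)).2.1 ⟨f 0, (hadj 0 (by omega)).1.symm⟩ _ hcard
    obtain ⟨b, hb, hbY, hbE, hbQ⟩ := hex (f (k + 1)) (hmulf k (by omega)) (col (k + 1))
      (hadj (k + 1) (by omega)).2.1 ⟨f (k + 2), (hadj (k + 1) (by omega)).1⟩ _ hcard
    rw [Finset.mem_union, not_or] at haQ hbQ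
    have hab : lab b = lab a := by
      rw [← hlab (col 0) (hadj 0 (by omega)).2.1 _ (hYf 0 (by omega)).2 a haY ha,
        ← hlab (col (k + 1)) (hadj (k + 1) (by omega)).2.1 _ (hYf (k + 1) (by omega)).1 b hbY hb]
      exact (hlabf _ (by omega)).trans (hlabf _ (by omega)).symm
    obtain ⟨l, l1, l2, l3, l4, l5⟩ := hconn b hbY a haY hab
    refine ⟨_, _, exists_isRainbowCycle_of_trail k f col hf hcol
      (fun i hi => (hadj i hi).1) ha hb l1 l2 ?_ l4 ?_, ?_, ?_, ?_⟩
    · rintro x hx i hi rfl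
      rcases l3 _ hx with h' | h' | h'
      · exact hfE i hi h'
      · exact hbQ.1 (h' ▸ hfin i hi)
      · exact haQ.1 (h' ▸ hfin i hi)
    · rintro c hc i hi rfl
      exact (hadj i hi).2.1 (l5 _ hc)
    · rw [Finset.disjoint_left]
      intro x hx hxS
      have hxS' := Finset.mem_sdiff.1 (hS hxS)
      rcases Finset.mem_union.1 hx with hx | hx
      · obtain ⟨i, hi, rfl⟩ := Finset.mem_image.1 hx
        exact hxS'.2 (hfin i (by rw [Finset.mem_Ico] at hi; omega))
      · rcases l3 x (List.mem_toFinset.1 hx) with h' | rfl | rfl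
        · exact Finset.mem_compl.1 hxS'.1 h'
        · exact hbQ.2 hxS
        · exact haQ.2 hxS
    · rw [← hcols, Finset.coe_subset]
      exact Finset.subset_union_left
    · rw [hcols, Finset.coe_union]
      exact Set.union_subset_union_right _ fun c hc => l5 c (List.mem_toFinset.1 hc)

theorem absorption_subgraph (δ : ℝ) (hδ : 0 < δ) :
    ∃ n₀ : ℕ, ∀ n : ℕ, n₀ ≤ n →
      ∀ (γ : Type) [Fintype γ] [DecidableEq γ] (G : γ → SimpleGraph (Fin n)),
        (∀ c : γ, (G c).edgeSet.Nonempty) →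
        (∀ v : Fin n,
          (∃ c₁ c₂ : γ, c₁ ≠ c₂ ∧ ((G c₁).neighborSet v).Nonempty ∧
            ((G c₂).neighborSet v).Nonempty) →
          ∀ c : γ, ((G c).neighborSet v).Nonempty →
            δ * n ≤ (((G c).neighborSet v).ncard : ℝ)) →
        ∃ (W : Finset (Fin n)) (G' : γ → SimpleGraph (Fin n)),
          (∀ c, G' c ≤ G c) ∧
          (∀ c u v, (G' c).Adj u v → u ∈ W ∧ v ∈ W) ∧
          (((Finset.univ \ W).card : ℝ) < 2000 / δ ^ 4) ∧
          ((({c : γ | (G' c).edgeSet = ∅} : Set γ).ncard : ℝ) < 2000 / δ ^ 4) ∧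
          ∀ (s : Finset (Fin n)) (cs : Finset γ), IsRainbowPath G' s cs → 3 ≤ s.card →
            ∀ S : Finset (Fin n), S ⊆ W \ s → ((s ∪ S).card : ℝ) ≤ δ * n / 4 →
              ∃ (s' : Finset (Fin n)) (cs' : Finset γ),
                IsRainbowCycle G s' cs' ∧ Disjoint s' S ∧
                ↑cs ⊆ (↑cs' : Set γ) ∧
                (↑cs' : Set γ) ⊆ ↑cs ∪ {c : γ | (G' c).edgeSet = ∅} := by
  refine ⟨⌈96 / δ ^ 3⌉₊ + 1, ?_⟩
  intro n hn γ _ _ G hne hdeg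
  classical
  have hn0 : 0 < n := by omega
  have : Nonempty (Fin n) := ⟨⟨0, hn0⟩⟩
  have hnR : (0 : ℝ) < n := by exact_mod_cast hn0
  have hdeg' : ∀ v, IsMulticoloured G v → ∀ c, (∃ w, (G c).Adj v w) →
      δ * (Fintype.card (Fin n) : ℝ) ≤ ((Finset.univ.filter ((G c).Adj v)).card : ℝ) := by
    intro v hv c hc
    have h := hdeg v hv c hc
    rw [Set.ncard_eq_toFinset_card'] at h
    rw [Fintype.card_fin]
    convert h using 3
    ext w
    simp
  by_cases hmul : ∃ v, IsMulticoloured G v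
  · obtain ⟨v₀, hv₀⟩ := hmul
    have hδ1 : δ ≤ 1 := by
      obtain ⟨c, -, -, hc, -⟩ := id hv₀
      have h1 := hdeg' v₀ hv₀ c hc
      have h2 : ((Finset.univ.filter ((G c).Adj v₀)).card : ℝ) ≤ Fintype.card (Fin n) := by
        exact_mod_cast Finset.card_le_univ _
      rw [Fintype.card_fin] at h1 h2
      exact le_of_mul_le_mul_right (by linarith) hnR
    exact absorption_subgraph_of_le_one hδ hδ1 n (by
      have h1 := Nat.le_ceil (96 / δ ^ 3)
      have h2 : ((⌈96 / δ ^ 3⌉₊ : ℕ) : ℝ) + 1 ≤ n := by exact_mod_cast hn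
      linarith) γ G hne hdeg'
  · push Not at hmul
    refine ⟨Finset.univ, G, fun _ => le_rfl, by simp, by simp; positivity, ?_, ?_⟩
    · have : {c : γ | (G c).edgeSet = ∅} = ∅ :=
        Set.eq_empty_of_forall_notMem fun c hc => (hne c).ne_empty hc
      rw [this]
      simp only [Set.ncard_empty, Nat.cast_zero]
      positivity
    · rintro s cs ⟨k, f, col, -, hks, -, -, hcol, -, hadj⟩ hs
      refine (hmul (f 1) ⟨col 0, col 1, fun e => ?_, ⟨f 0, ?_⟩, ⟨f 2, ?_⟩⟩).elim
      · exact zero_ne_one (hcol (by simp; omega) (by simp; omega) e)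
      · exact (hadj 0 (by omega)).symm
      · exact hadj 1 (by omega)
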